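/- arXiv:1803.02275 — 10 statements merged into one kernel-verified Lean document; each statement's English description precedes it below -/
import Mathlib

section
/- Let X be a set, B ⊆ X, and let ℒ be a connectivity structure on B (i.e. ℒ is a collection of subsets of B containing the empty set, and for every family of members of ℒ whose intersection is nonempty, the union of the family belongs to ℒ). Then ℒ ∪ (𝒫(X) \ 𝒫(B)) is a connectivity structure on X, and the set of members of ℒ ∪ (𝒫(X) \ 𝒫(B)) that are contained in B equals ℒ. -/
/-- A connectivity structure on `X`: contains `∅`, and is stable under unions of
families with nonempty intersection. -/
def IsConnStruct {X : Type} (K : Set (Set X)) : Prop :=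
  ∅ ∈ K ∧ ∀ S : Set (Set X), S ⊆ K → (⋂₀ S).Nonempty → ⋃₀ S ∈ K

theorem stmt0 {X : Type} (B : Set X) (L : Set (Set X))
    (hLB : L ⊆ Set.powerset B)
    (hL0 : ∅ ∈ L)
    (hLu : ∀ S : Set (Set X), S ⊆ L → (⋂₀ S).Nonempty → ⋃₀ S ∈ L) :
    IsConnStruct (L ∪ (Set.powerset B)ᶜ) ∧
      (L ∪ (Set.powerset B)ᶜ) ∩ Set.powerset B = L := by
  refine ⟨⟨Or.inl hL0, fun S hS hne => ?_⟩, ?_⟩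
  · by_cases h : ⋃₀ S ⊆ B
    · left
      refine hLu S (fun s hs => ?_) hne
      rcases hS hs with h1 | h1
      · exact h1
      · exact absurd ((Set.subset_sUnion_of_mem hs).trans h) h1
    · exact Or.inr h
  · ext s
    constructor
    · rintro ⟨h1 | h1, h2⟩
      · exact h1
      · exact absurd h2 h1
    · intro h
      exact ⟨Or.inl h, hLB h⟩
end

section
/- For every set X, every collection 𝒞 of subsets of X and every subset B ⊆ X, one has [𝒞 ∩ 𝒫(B)] = [𝒞] ∩ 𝒫(B); in other words, the connectivity structure generated by the members of 𝒞 contained in B equals the set of members of [𝒞] contained in B. -/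
/-- The connectivity structure generated by a collection `C` of subsets of `X`:
the intersection of all connectivity structures containing `C`. -/
def genConn {X : Type} (C : Set (Set X)) : Set (Set X) :=
  ⋂₀ {L | IsConnStruct L ∧ C ⊆ L}

theorem stmt1 {X : Type} (C : Set (Set X)) (B : Set X) :
    genConn (C ∩ Set.powerset B) = genConn C ∩ Set.powerset B := by
  apply Set.Subset.antisymm
  · intro A hA
    refine hA (genConn C ∩ Set.powerset B) ⟨⟨⟨?_, ?_⟩, ?_⟩, ?_⟩
    · intro L hL
      exact hL.1.1
    · exact Set.empty_subset B
    · intro S hS hne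
      refine ⟨?_, ?_⟩
      · intro L hL
        exact hL.1.2 S (fun T hT => (hS hT).1 L hL) hne
      · exact Set.sUnion_subset (fun T hT => (hS hT).2)
    · intro T hT
      exact ⟨fun L hL => hL.2 hT.1, hT.2⟩
  · rintro A ⟨hA, hB⟩ L ⟨hL, hC⟩
    refine hA {T | T ⊆ B → T ∈ L} ⟨⟨?_, ?_⟩, ?_⟩ hB
    · intro _
      exact hL.1
    · intro S hS hne hSB
      exact hL.2 S (fun T hT => hS hT ((Set.subset_sUnion_of_mem hT).trans hSB)) hne
    · intro T hT hTB
      exact hC ⟨hT, hTB⟩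
end

section
/- For every set X, every collection 𝒞 of subsets of X and every subset B ⊆ X, one has [𝒞 ∩ 𝒫(B)]₁ ∩ 𝒫(B) = [𝒞]₁ ∩ 𝒫(B), where [𝒟]₁ denotes the integral connectivity structure generated by a collection 𝒟, i.e. the smallest connectivity structure on X containing 𝒟 and all singletons {x} for x ∈ X; moreover [𝒟]₁ = [𝒟] ∪ {{x} : x ∈ X}. -/
/-- The integral connectivity structure generated by `C`: the smallest connectivity
structure containing `C` and all singletons. -/
def genConnI {X : Type} (C : Set (Set X)) : Set (Set X) :=
  ⋂₀ {L | IsConnStruct L ∧ (∀ x : X, {x} ∈ L) ∧ C ⊆ L}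

theorem genConn_isConn {X : Type} (C : Set (Set X)) : IsConnStruct (genConn C) := by
  refine ⟨fun L hL => hL.1.1, fun S hS hne L hL => hL.1.2 S (fun A hA => hS hA L hL) hne⟩

theorem genConnI_isConn {X : Type} (C : Set (Set X)) : IsConnStruct (genConnI C) := by
  refine ⟨fun L hL => hL.1.1, fun S hS hne L hL => hL.1.2 S (fun A hA => hS hA L hL) hne⟩

theorem stmt2 {X : Type} (C : Set (Set X)) (B : Set X) :
    genConnI (C ∩ Set.powerset B) ∩ Set.powerset B = genConnI C ∩ Set.powerset B ∧
      ∀ D : Set (Set X), genConnI D = genConn D ∪ {S : Set X | ∃ x : X, S = {x}} := by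
  constructor
  · apply Set.Subset.antisymm
    · rintro A ⟨hA, hB⟩
      exact ⟨fun L hL => hA L ⟨hL.1, hL.2.1, fun Z hZ => hL.2.2 hZ.1⟩, hB⟩
    · rintro A ⟨hA, hB⟩
      refine ⟨?_, hB⟩
      have hK := genConnI_isConn (C ∩ Set.powerset B)
      refine hA {Z | Z ⊆ B → Z ∈ genConnI (C ∩ Set.powerset B)} ⟨⟨?_, ?_⟩, ?_, ?_⟩ hB
      · exact fun _ => hK.1
      · intro S hS hne hSB
        exact hK.2 S (fun Z hZ => hS hZ (fun z hz => hSB ⟨Z, hZ, hz⟩)) hne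
      · exact fun x _ L hL => hL.2.1 x
      · exact fun Z hZ hZB L hL => hL.2.2 ⟨hZ, hZB⟩
  · intro D
    have hG := genConn_isConn D
    apply Set.Subset.antisymm
    · intro A hA
      refine hA _ ⟨⟨Or.inl hG.1, ?_⟩, fun x => Or.inr ⟨x, rfl⟩,
        fun Z hZ => Or.inl fun L hL => hL.2 hZ⟩
      rintro S hS ⟨p, hp⟩
      have hsing : ∀ Z ∈ S, Z ∈ genConn D ∨ Z = {p} := by
        intro Z hZ
        rcases hS hZ with h | ⟨x, rfl⟩
        · exact Or.inl h
        · have : p = x := hp _ hZ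
          exact Or.inr (by rw [this])
      by_cases hT : ∃ T ∈ S, T ∈ genConn D
      · obtain ⟨T, hTS, hTG⟩ := hT
        left
        have he : ⋃₀ S = ⋃₀ (S ∩ genConn D) := by
          apply Set.Subset.antisymm
          · rintro z ⟨Z, hZ, hz⟩
            rcases hsing Z hZ with h | rfl
            · exact ⟨Z, ⟨hZ, h⟩, hz⟩
            · have : z = p := hz
              subst this
              exact ⟨T, ⟨hTS, hTG⟩, hp T hTS⟩
          · exact Set.sUnion_subset_sUnion Set.inter_subset_left
        rw [he]
        exact hG.2 _ Set.inter_subset_right ⟨p, fun Z hZ => hp Z hZ.1⟩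
      · have h1 : ∀ Z ∈ S, Z = {p} := fun Z hZ =>
          (hsing Z hZ).resolve_left fun h => hT ⟨Z, hZ, h⟩
        rcases S.eq_empty_or_nonempty with rfl | ⟨Z, hZ⟩
        · left
          rw [Set.sUnion_empty]
          exact hG.1
        · right
          refine ⟨p, Set.Subset.antisymm ?_ ?_⟩
          · rintro z ⟨W, hW, hz⟩
            rw [h1 W hW] at hz
            exact hz
          · rw [← h1 Z hZ]
            exact Set.subset_sUnion_of_mem hZ
    · rintro A (hA | ⟨x, rfl⟩) L hL
      · exact hA L ⟨hL.1, hL.2.2⟩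
      · exact hL.2.1 x
end

section
/- Let (X,𝒦) be a connectivity space and K ∈ 𝒦. Then K is irreducible (i.e. K ∉ [𝒦 \ {K}]) if and only if the only sieve σ on K with [σ̇] = 𝒦 ∩ 𝒫(K) is the maximal sieve on K (the sieve whose set of elements is all of 𝒦 ∩ 𝒫(K)). -/
open CategoryTheory

/-- The set `σ̇` of elements of a sieve `σ` on `A` in the poset category `𝒦`. -/
def sieveSet {X : Type} {K : Set (Set X)} {A : ↥K} (σ : Sieve A) : Set (Set X) :=
  {B | ∃ (hB : B ∈ K) (hle : (⟨B, hB⟩ : ↥K) ≤ A), σ.arrows (homOfLE hle)}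

theorem connStruct_inter {X : Type} {K : Set (Set X)} (hK : IsConnStruct K) (A : Set X) :
    IsConnStruct (K ∩ Set.powerset A) := by
  refine ⟨⟨hK.1, Set.empty_subset _⟩, fun S hS hne => ⟨hK.2 S (fun B hB => (hS hB).1) hne, ?_⟩⟩
  exact Set.sUnion_subset fun B hB => (hS hB).2

theorem sieveSet_sub {X : Type} {K : Set (Set X)} {A : ↥K} (σ : Sieve A) :
    sieveSet σ ⊆ K ∩ Set.powerset A.1 := by
  rintro B ⟨hB, hle, -⟩
  exact ⟨hB, hle⟩

theorem stmt4 {X : Type} (K : Set (Set X)) (hK : IsConnStruct K) (A : ↥K) :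
    A.1 ∉ genConn (K \ {A.1}) ↔
      {σ : Sieve A | genConn (sieveSet σ) = K ∩ Set.powerset A.1} = {⊤} := by
  have gle : ∀ σ : Sieve A, genConn (sieveSet σ) ⊆ K ∩ Set.powerset A.1 := fun σ B hB =>
    hB _ ⟨connStruct_inter hK A.1, sieveSet_sub σ⟩
  constructor
  · intro h
    ext σ
    simp only [Set.mem_ofPred_eq, Set.mem_singleton_iff]
    constructor
    · intro hσ
      by_contra hne
      apply h
      have hA : A.1 ∈ genConn (sieveSet σ) := by
        rw [hσ]
        exact ⟨A.2, Set.Subset.refl A.1⟩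
      intro L hL
      refine hA L ⟨hL.1, fun B hB => hL.2 ⟨(sieveSet_sub σ hB).1, ?_⟩⟩
      rintro rfl
      obtain ⟨_, hle, harr⟩ := hB
      exact hne (Sieve.id_mem_iff_eq_top.1 harr)
    · rintro rfl
      apply Set.Subset.antisymm (gle _)
      rintro B ⟨hB, hBA⟩ L hL
      exact hL.2 ⟨hB, hBA, trivial⟩
  · intro h hA
    let σ : Sieve A :=
      { arrows := fun B _ => B.1 ≠ A.1
        downward_closed := by
          intro Y Z f hf g hZ
          apply hf
          apply Set.Subset.antisymm (leOfHom f)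
          rw [← hZ]
          exact leOfHom g }
    have hσ : σ ∈ {σ : Sieve A | genConn (sieveSet σ) = K ∩ Set.powerset A.1} := by
      apply Set.Subset.antisymm (gle _)
      rintro B ⟨hB, hBA⟩ L hL
      by_cases hBe : B = A.1
      · subst hBe
        have key := hA {B | B ⊆ A.1 → B ∈ L} ⟨⟨fun _ => hL.1.1, ?_⟩, ?_⟩
        · exact key (Set.Subset.refl A.1)
        · intro S hS hne hsub
          exact hL.1.2 S (fun B hB => hS hB ((Set.subset_sUnion_of_mem hB).trans hsub)) hne
        · intro B hB hBA
          exact hL.2 ⟨hB.1, hBA, hB.2⟩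
      · exact hL.2 ⟨hB, hBA, hBe⟩
    rw [h] at hσ
    have hid : σ.arrows (𝟙 A) := Sieve.id_mem_iff_eq_top.2 hσ
    exact hid rfl
end

section
/- Let (X,𝒦) be a connectivity space with its Grothendieck topology J on the poset category (𝒦,⊆), where a sieve σ on A ∈ 𝒦 is covering iff [σ̇] = 𝒦 ∩ 𝒫(A). Then J is subcanonical: for every C ∈ 𝒦, the representable presheaf Hom(−, C) on the poset (𝒦,⊆) is a J-sheaf. -/
open CategoryTheory

theorem stmt6 {X : Type} (K : Set (Set X)) (hK : IsConnStruct K)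
    (J : GrothendieckTopology ↥K)
    (hJ : ∀ (A : ↥K) (σ : Sieve A),
      σ ∈ J A ↔ genConn (sieveSet σ) = K ∩ Set.powerset A.1) :
    ∀ C : ↥K, Presieve.IsSheaf J (yoneda.obj C) := by
  intro C A σ hσ x hx
  have hgen := (hJ A σ).1 hσ
  have hA : A.1 ∈ genConn (sieveSet σ) := by
    rw [hgen]
    exact ⟨A.2, fun _ h => h⟩
  have hAC : A.1 ∈ Set.powerset C.1 := by
    refine hA (Set.powerset C.1) ⟨⟨Set.empty_subset _, ?_⟩, ?_⟩
    · intro S hS _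
      exact Set.sUnion_subset fun B hB => hS hB
    · rintro B ⟨hB, hle, hσB⟩
      exact leOfHom (x (homOfLE hle) hσB)
  have hle : A ≤ C := hAC
  refine ⟨homOfLE hle, ?_, ?_⟩
  · intro Y f hf
    exact Subsingleton.elim (α := Y ⟶ C) _ _
  · intro y _
    exact Subsingleton.elim (α := A ⟶ C) _ _
end

section
/- Let (X,𝒦) be a finite connectivity space (X a finite set). Then the irreducible connected sets generate the structure: [Irr_{(X,𝒦)}] = 𝒦, where Irr_{(X,𝒦)} is the set of irreducible members of 𝒦. -/
/-- The set of irreducible connected sets of a connectivity space `(X, K)`. -/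
def Irr {X : Type} (K : Set (Set X)) : Set (Set X) :=
  {A ∈ K | A ∉ genConn (K \ {A})}

theorem stmt7 {X : Type} [Finite X] (K : Set (Set X)) (hK : IsConnStruct K) :
    genConn (Irr K) = K := by
  apply Set.Subset.antisymm
  · intro A hA
    exact hA K ⟨hK, fun B hB => hB.1⟩
  · intro A hA L hL
    induction A using WellFoundedLT.induction with
    | ind A ih =>
      by_cases hI : A ∈ genConn (K \ {A})
      · have h := hI {B | B ⊆ A → B ∈ L} ⟨⟨fun _ => hL.1.1, ?_⟩, ?_⟩
        · exact h (Set.Subset.refl A)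
        · intro S hS hne hsub
          exact hL.1.2 S
            (fun B hB => hS hB ((Set.subset_sUnion_of_mem hB).trans hsub)) hne
        · intro B hB hsub
          exact ih B (lt_of_le_of_ne hsub hB.2) hB.1
      · exact hL.2 ⟨hA, hI⟩
end

section
/- Let (𝒜,≤) be a finite partial order and let ℒ = [{↓z : z ∈ 𝒜}] be the connectivity structure on the set 𝒜 generated by the principal lower sets ↓z = {x ∈ 𝒜 : x ≤ z}. Then the irreducible connected sets of the connectivity space (𝒜,ℒ) are exactly the sets of the form ↓z with z ∈ 𝒜: every ↓z is irreducible, and every irreducible member of ℒ equals ↓z for some z ∈ 𝒜. -/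
theorem stmt10 (A : Type) [PartialOrder A] [Fintype A]
    (L : Set (Set A)) (hL : L = genConn {S : Set A | ∃ z : A, S = Set.Iic z}) :
    Irr L = {S : Set A | ∃ z : A, S = Set.Iic z} := by
  subst hL
  have hc : IsConnStruct (genConn {S : Set A | ∃ z : A, S = Set.Iic z}) := by
    refine ⟨fun M hM => hM.1.1, fun S hS hn M hM => hM.1.2 S (fun T hT => hS hT M hM) hn⟩
  have hlow : ∀ T ∈ genConn {S : Set A | ∃ z : A, S = Set.Iic z}, IsLowerSet T := by
    intro T hT
    refine hT {T | IsLowerSet T} ⟨⟨isLowerSet_empty, fun S hS _ => isLowerSet_sUnion hS⟩, ?_⟩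
    rintro _ ⟨z, rfl⟩
    exact isLowerSet_Iic z
  ext K
  constructor
  · rintro ⟨hK, hI⟩
    by_contra hz
    refine hI fun M hM => hK M ⟨hM.1, fun G hG => hM.2 ⟨fun N hN => hN.2 hG, ?_⟩⟩
    rintro rfl
    exact hz hG
  · rintro ⟨z, rfl⟩
    refine ⟨fun N hN => hN.2 ⟨z, rfl⟩, fun h => ?_⟩
    refine (h (genConn {S : Set A | ∃ z : A, S = Set.Iic z} \ {Set.Iic z})
      ⟨⟨⟨hc.1, ?_⟩, ?_⟩, subset_rfl⟩).2 rfl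
    · intro he
      have he' : (∅ : Set A) = Set.Iic z := he
      have : z ∈ (∅ : Set A) := he' ▸ (le_refl z : z ∈ Set.Iic z)
      exact this
    · intro S hS hn
      refine ⟨hc.2 S (fun T hT => (hS hT).1) hn, fun he => ?_⟩
      have he' : ⋃₀ S = Set.Iic z := he
      have hz : z ∈ ⋃₀ S := he' ▸ (le_refl z : z ∈ Set.Iic z)
      obtain ⟨T, hT, hzT⟩ := hz
      refine (hS hT).2 (Set.Subset.antisymm (he' ▸ Set.subset_sUnion_of_mem hT) ?_)
      intro x hx
      exact hlow T (hS hT).1 hx hzT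
end

section
/- Let f : (E₁,𝒯₁) → (E₂,𝒯₂) be a continuous map between finite topological spaces, and let ω be an irreducible open set of E₁. Then the smallest open set of E₂ containing f(ω), namely the intersection of all open sets of E₂ containing the image f(ω) (which is open since E₂ is finite), is an irreducible open set of E₂. -/
/-- An open set `U` is irreducible if it is nonempty and whenever `U = V ∪ W`
with `V`, `W` open, then `V = U` or `W = U`. -/
def IrrOpenSet {E : Type} [TopologicalSpace E] (U : Set E) : Prop :=
  IsOpen U ∧ U.Nonempty ∧
    ∀ V W : Set E, IsOpen V → IsOpen W → U = V ∪ W → V = U ∨ W = U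

theorem stmt13 {E₁ E₂ : Type} [TopologicalSpace E₁] [TopologicalSpace E₂]
    [Finite E₁] [Finite E₂] (f : E₁ → E₂) (hf : Continuous f)
    (ω : Set E₁) (hω : IrrOpenSet ω) :
    IrrOpenSet (⋂₀ {W : Set E₂ | IsOpen W ∧ f '' ω ⊆ W}) := by
  obtain ⟨ho, ⟨x, hx⟩, hirr⟩ := hω
  have hsub : f '' ω ⊆ ⋂₀ {W : Set E₂ | IsOpen W ∧ f '' ω ⊆ W} :=
    Set.subset_sInter fun W hW => hW.2
  have key : ∀ V : Set E₂, IsOpen V → ω ∩ f ⁻¹' V = ω →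
      ⋂₀ {W : Set E₂ | IsOpen W ∧ f '' ω ⊆ W} ⊆ V := by
    intro V hV h
    refine Set.sInter_subset_of_mem ⟨hV, ?_⟩
    rintro _ ⟨y, hy, rfl⟩
    rw [← h] at hy
    exact hy.2
  refine ⟨(Set.toFinite _).isOpen_sInter fun W hW => hW.1,
    ⟨f x, hsub ⟨x, hx, rfl⟩⟩, ?_⟩
  intro V W hV hW hU
  have hcov : ω = (ω ∩ f ⁻¹' V) ∪ (ω ∩ f ⁻¹' W) := by
    rw [← Set.inter_union_distrib_left, ← Set.preimage_union, ← hU]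
    exact (Set.inter_eq_left.mpr (Set.image_subset_iff.mp hsub)).symm
  rcases hirr _ _ (ho.inter (hV.preimage hf)) (ho.inter (hW.preimage hf)) hcov with h | h
  · exact Or.inl (Set.Subset.antisymm (hU ▸ Set.subset_union_left) (key V hV h))
  · exact Or.inr (Set.Subset.antisymm (hU ▸ Set.subset_union_right) (key W hW h))
end

section
/- Let (E,𝒯) be a finite topological space and let ℋ be the poset, ordered by inclusion, of irreducible open sets of E. Then there is an equivalence of categories between the category of sheaves of types on E (sheaves for the canonical Grothendieck topology on the poset of open sets of E, whose covering sieves on an open U are the sieves σ with ⋃σ = U) and the category of presheaves of types on ℋ, i.e. the functor category from ℋᵒᵖ to the category of types. -/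
open CategoryTheory TopologicalSpace

theorem irr_min {E : Type} [TopologicalSpace E] {U : Set E} (hU : IrrOpenSet U)
    {s : Set (Set E)} (hs : s.Finite) (ho : ∀ V ∈ s, IsOpen V) (h : U ⊆ ⋃₀ s) :
    ∃ V ∈ s, U ⊆ V := by
  induction s, hs using Set.Finite.induction_on with
  | empty =>
    obtain ⟨x, hx⟩ := hU.2.1
    simpa using h hx
  | @insert a s _ _ ih =>
    have hso : IsOpen (⋃₀ s) := isOpen_sUnion fun V hV => ho V (Set.mem_insert_of_mem _ hV)
    rw [Set.sUnion_insert] at h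
    rcases hU.2.2 (U ∩ a) (U ∩ ⋃₀ s) (hU.1.inter (ho a (Set.mem_insert _ _)))
      (hU.1.inter hso) (by rw [← Set.inter_union_distrib_left, Set.inter_eq_left.2 h]) with h1 | h1
    · exact ⟨a, Set.mem_insert _ _, Set.inter_eq_left.1 h1⟩
    · obtain ⟨V, hV, hUV⟩ := ih (fun V hV => ho V (Set.mem_insert_of_mem _ hV))
        (Set.inter_eq_left.1 h1)
      exact ⟨V, Set.mem_insert_of_mem _ hV, hUV⟩

theorem ker_minimal {E : Type} [TopologicalSpace E] [Finite E] {s V : Set E}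
    (h : s ⊆ V) (hV : IsOpen V) : nhdsKer s ⊆ V :=
  nhdsKer_subset_iff.2 ⟨V, hV, h, subset_rfl⟩

theorem irr_ker {E : Type} [TopologicalSpace E] [Finite E] (x : E) :
    IrrOpenSet (nhdsKer {x}) := by
  have hx : x ∈ nhdsKer {x} := subset_nhdsKer rfl
  refine ⟨isOpen_nhdsKer, ⟨x, hx⟩, ?_⟩
  intro V W hV hW h
  have hx' := hx
  rw [h] at hx'
  rcases hx' with h1 | h1
  · left
    exact (h ▸ Set.subset_union_left).antisymm
      (ker_minimal (Set.singleton_subset_iff.2 h1) hV)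
  · right
    exact (h ▸ Set.subset_union_right).antisymm
      (ker_minimal (Set.singleton_subset_iff.2 h1) hW)

/-- Inclusion of the irreducible open sets in all open sets. -/
def irrIncl (E : Type) [TopologicalSpace E] : ↥{U : Set E | IrrOpenSet U} ⥤ Opens E where
  obj U := ⟨U.1, U.2.1⟩
  map f := homOfLE (fun _ hx => leOfHom f hx)

instance (E : Type) [TopologicalSpace E] : (irrIncl E).Full where
  map_surjective f := ⟨homOfLE (fun _ hx => leOfHom f hx), rfl⟩

instance (E : Type) [TopologicalSpace E] : (irrIncl E).Faithful where
  map_injective _ := Subsingleton.elim _ _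

instance irrDense (E : Type) [TopologicalSpace E] [Finite E] :
    (irrIncl E).IsCoverDense (Opens.grothendieckTopology E) where
  is_cover U x hx := by
    have hle : nhdsKer {x} ⊆ U.1 := ker_minimal (Set.singleton_subset_iff.2 hx) U.2
    exact ⟨(irrIncl E).obj ⟨nhdsKer {x}, irr_ker x⟩, homOfLE hle,
      Presieve.in_coverByImage _ _, subset_nhdsKer rfl⟩

instance irrSubsite (E : Type) [TopologicalSpace E] [Finite E] :
    (irrIncl E).IsDenseSubsite ⊥ (Opens.grothendieckTopology E) where
  functorPushforward_mem_iff {X S} := by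
    rw [GrothendieckTopology.bot_covering]
    constructor
    · intro h
      obtain ⟨V, ⟨W, ⟨f, hf, rfl⟩⟩, hV⟩ := irr_min X.2
        (s := {V | ∃ W : ↥{U : Set E | IrrOpenSet U}, ∃ f : W ⟶ X, S f ∧ V = W.1})
        (Set.toFinite _) (by rintro V ⟨W, f, _, rfl⟩; exact W.2.1)
        (by
          intro x hx
          obtain ⟨V, g, ⟨W, f, k, hf, _⟩, hxV⟩ := h x hx
          exact ⟨W.1, ⟨W, f, hf, rfl⟩, leOfHom k hxV⟩)
      rw [← Sieve.id_mem_iff_eq_top]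
      have g : X ⟶ W := homOfLE hV
      have h2 := S.downward_closed hf g
      rwa [Subsingleton.elim (g ≫ f) (𝟙 X)] at h2
    · rintro rfl
      rw [Sieve.functorPushforward_top]
      exact GrothendieckTopology.top_mem _ _

theorem stmt14 (E : Type) [TopologicalSpace E] [Finite E] :
    Nonempty (Sheaf (Opens.grothendieckTopology E) (Type) ≌
      ((↥{U : Set E | IrrOpenSet U})ᵒᵖ ⥤ Type)) := by
  exact ⟨(Functor.IsDenseSubsite.sheafEquiv ⊥ (Opens.grothendieckTopology E)
    (irrIncl E) Type).symm.trans (sheafBotEquivalence _)⟩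
end

section
/- Let (𝒜,≤) be a finite partial order and equip the set 𝒜 with the topology generated by the sets ↓e = {x ∈ 𝒜 : x ≤ e} for e ∈ 𝒜. Then there is an equivalence of categories between the category of sheaves of types on this topological space (sheaves for the usual Grothendieck topology on its poset of open sets, whose covering sieves on an open U are the sieves σ with ⋃σ = U) and the category of presheaves of types on (𝒜,≤), i.e. the functor category from (𝒜,≤)ᵒᵖ to the category of types. -/
open CategoryTheory TopologicalSpace

theorem stmt18_lower {A : Type} [PartialOrder A] {U : Set A}
    (h : GenerateOpen {S : Set A | ∃ e : A, S = Set.Iic e} U) : IsLowerSet U := by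
  induction h with
  | basic s hs => obtain ⟨e, rfl⟩ := hs; exact isLowerSet_Iic e
  | univ => exact isLowerSet_univ
  | inter s t _ _ h1 h2 => exact h1.inter h2
  | sUnion S _ h => exact isLowerSet_sUnion h

theorem stmt18 (A : Type) [PartialOrder A] [Fintype A]
    [t : TopologicalSpace A]
    (ht : t = TopologicalSpace.generateFrom {S : Set A | ∃ e : A, S = Set.Iic e}) :
    Nonempty (Sheaf (Opens.grothendieckTopology A) (Type) ≌ (Aᵒᵖ ⥤ Type)) := by
  have hopen : ∀ e : A, IsOpen (Set.Iic e) := fun e => by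
    rw [ht]; exact isOpen_generateFrom_of_mem ⟨e, rfl⟩
  have hlow : ∀ U : Opens A, IsLowerSet (U : Set A) := fun U => by
    have h := U.isOpen
    generalize (U : Set A) = V at h
    subst ht
    exact stmt18_lower h
  let m : A → Opens A := fun e => ⟨Set.Iic e, hopen e⟩
  have hm : Monotone m := fun a b hab => Set.Iic_subset_Iic.2 hab
  let G : A ⥤ Opens A := hm.functor
  have hfull : G.Full := ⟨fun {a b} f =>
    ⟨homOfLE (show a ∈ Set.Iic b from f.le (show a ∈ Set.Iic a from le_rfl)),
      Subsingleton.elim _ _⟩⟩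
  have hfaith : G.Faithful := ⟨fun _ => Subsingleton.elim _ _⟩
  have hdense : G.IsCoverDense (Opens.grothendieckTopology A) := ⟨fun U x hx =>
    ⟨m x, homOfLE (fun y hy => hlow U hy hx),
      Presieve.in_coverByImage G (Y := x) (homOfLE (fun y hy => hlow U hy hx)),
      show x ∈ Set.Iic x from le_rfl⟩⟩
  have hsub : G.IsDenseSubsite (⊥ : GrothendieckTopology A) (Opens.grothendieckTopology A) := by
    refine ⟨inferInstance, inferInstance, inferInstance, ?_⟩
    intro X S
    rw [GrothendieckTopology.bot_covering]
    constructor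
    · intro h
      obtain ⟨V, f, ⟨Z, g, k, hg, _⟩, hx⟩ := h X (show X ∈ Set.Iic X from le_rfl)
      have hXZ : X ≤ Z := k.le hx
      have := S.downward_closed hg (homOfLE hXZ)
      rw [← Sieve.id_mem_iff_eq_top]
      rwa [Subsingleton.elim (𝟙 X) (homOfLE hXZ ≫ g)]
    · rintro rfl
      simp
  exact ⟨(G.sheafPushforwardContinuous (Type) ⊥
    (Opens.grothendieckTopology A)).asEquivalence.trans (sheafBotEquivalence _)⟩
end
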